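/- arXiv:1205.1331 — 9 statements merged into one kernel-verified Lean document; each statement's English description precedes it below -/
import Mathlib

section
/- Let ℓ_1=(s_1,r_1),…,ℓ_n=(s_n,r_n) be links indexed so that β_1·d(ℓ_1)^α ≥ β_2·d(ℓ_2)^α ≥ … ≥ β_n·d(ℓ_n)^α (nonincreasing sensitivity). Set τ = 1/(6·3^α + 2) and suppose that for every i ∈ {1,…,n} we have Σ_{j=1}^n w(ℓ_j, ℓ_i) ≤ τ. Define transmission powers recursively (in order i = 1,…,n) by p_i = 2·β_i·N·dist(s_i,r_i)^α + 2·β_i·Σ_{j<i} (p_j/dist(s_j,r_i)^α)·dist(s_i,r_i)^α. Then for every i ∈ {1,…,n}, the SINR of link ℓ_i in the set L = {ℓ_1,…,ℓ_n} under the power assignment p satisfies γ_{ℓ_i}(L,p) ≥ β_i. -/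
open Finset

noncomputable def sinr {X : Type*} {ι : Type*} [MetricSpace X] [DecidableEq ι]
    (α N : ℝ) (s r : ι → X) (p : ι → ℝ) (L : Finset ι) (i : ι) : ℝ :=
  (p i / dist (s i) (r i) ^ α) /
    ((∑ j ∈ L.erase i, p j / dist (s j) (r i) ^ α) + N)

/-- The weight `w(ℓ_i, ℓ_j)` between two links, where `π` gives the processing order
(by nonincreasing sensitivity `β(ℓ)·d(ℓ)^α`); it is nonzero exactly when `π i > π j`. -/
noncomputable def weight {X : Type*} {ι : Type*} [MetricSpace X]
    (α : ℝ) (s r : ι → X) (β : ι → ℝ) (π : ι → ℕ) (i j : ι) : ℝ :=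
  if π j < π i then
    min 1 (β i * β j * (dist (s i) (r i) ^ α * dist (s j) (r j) ^ α) /
        (dist (s i) (r j) ^ α * dist (s j) (r i) ^ α)
      + β i * dist (s i) (r i) ^ α / dist (s i) (r j) ^ α
      + β i * dist (s i) (r i) ^ α / dist (s j) (r i) ^ α)
  else 0

theorem aux_rpow_three (α a b c x : ℝ) (hα : 1 ≤ α) (ha : 0 ≤ a) (hb : 0 ≤ b) (hc : 0 ≤ c)
    (hx0 : 0 ≤ x) (hx : x ≤ a + b + c) :
    x ^ α ≤ (3:ℝ) ^ α / 3 * (a ^ α + b ^ α + c ^ α) := by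
  have h := Real.rpow_sum_le_const_mul_sum_rpow (Finset.univ : Finset (Fin 3)) ![a, b, c] hα
  simp only [Fin.sum_univ_three, Finset.card_univ, Fintype.card_fin] at h
  simp only [Matrix.cons_val_zero, Matrix.cons_val_one, Matrix.cons_val, abs_of_nonneg ha,
    abs_of_nonneg hb, abs_of_nonneg hc] at h
  rw [Nat.cast_ofNat, Real.rpow_sub (by norm_num), Real.rpow_one] at h
  exact le_trans (Real.rpow_le_rpow hx0 hx (by linarith)) h

theorem aux_abstract (n : ℕ) (N c τ : ℝ) (hN : 0 < N) (hc : 1 ≤ c) (hτ : τ = 1 / (6 * c + 2))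
    (D : Fin n → Fin n → ℝ) (hD : ∀ i j, 0 < D i j) (β : Fin n → ℝ) (hβ : ∀ i, 1 ≤ β i)
    (htri : ∀ k j i, D k i ≤ c / 3 * (D k j + D j j + D j i))
    (W : Fin n → Fin n → ℝ) (hW0 : ∀ j i, 0 ≤ W j i)
    (hW : ∀ j i, i < j → W j i = min 1 (β j * β i * (D j j * D i i) / (D j i * D i j)
      + β j * D j j / D j i + β j * D j j / D i j))
    (hsel : ∀ i, ∑ j, W j i ≤ τ) (p : Fin n → ℝ)
    (hp : ∀ i, p i = 2 * β i * N * D i i + 2 * β i * ∑ j ∈ Finset.Iio i, p j / D j i * D i i)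
    (i : Fin n) : β i ≤ (p i / D i i) / ((∑ j ∈ Finset.univ.erase i, p j / D j i) + N) := by
  have hb0 : ∀ i, 0 < β i := fun i => lt_of_lt_of_le one_pos (hβ i)
  have hτ1 : τ < 1 := by
    rw [hτ, div_lt_one (by linarith)]; linarith
  have hτ0 : 0 < τ := by rw [hτ]; positivity
  have hp0 : ∀ i, 0 ≤ p i := by
    intro i
    induction i using WellFoundedLT.induction with
    | ind i ih =>
      rw [hp i]
      have h1 := hD i i
      have h2 := hb0 i
      have h3 : 0 ≤ ∑ j ∈ Finset.Iio i, p j / D j i * D i i :=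
        Finset.sum_nonneg fun j hj =>
          mul_nonneg (div_nonneg (ih j (Finset.mem_Iio.1 hj)) (hD j i).le) h1.le
      positivity
  have hW1 : ∀ j i, i < j → β j * β i * (D j j * D i i) / (D j i * D i j)
      + β j * D j j / D j i + β j * D j j / D i j = W j i := by
    intro j i hij
    have h1 : W j i < 1 := lt_of_le_of_lt
      ((Finset.single_le_sum (f := fun j => W j i) (fun j _ => hW0 j i)
        (Finset.mem_univ j)).trans (hsel i)) hτ1
    rw [hW j i hij] at h1 ⊢
    rcases min_lt_iff.1 h1 with h | h
    · exact absurd h (lt_irrefl _)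
    · exact (min_eq_right h.le).symm
  have hW2 : ∀ j i, i < j → W j i < 1 := fun j i _ => lt_of_le_of_lt
      ((Finset.single_le_sum (f := fun j => W j i) (fun j _ => hW0 j i)
        (Finset.mem_univ j)).trans (hsel i)) hτ1
  have hWpos : ∀ j i, 0 < β j * D j j / D j i ∧ 0 < β j * D j j / D i j ∧
      0 < β j * β i * (D j j * D i i) / (D j i * D i j) := by
    intro j i
    have := hb0 j; have := hb0 i; have := hD j i; have := hD i j; have := hD j j; have := hD i i
    refine ⟨?_, ?_, ?_⟩ <;> positivity
  have hWa : ∀ j i, i < j → β j * D j j / D j i ≤ W j i := by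
    intro j i hij
    obtain ⟨h1, h2, h3⟩ := hWpos j i
    linarith [hW1 j i hij]
  have hWb : ∀ j i, i < j → β j * D j j / D i j ≤ W j i := by
    intro j i hij
    obtain ⟨h1, h2, h3⟩ := hWpos j i
    linarith [hW1 j i hij]
  have hWc : ∀ j i, i < j → β j * β i * (D j j * D i i) / (D j i * D i j) ≤ W j i := by
    intro j i hij
    obtain ⟨h1, h2, h3⟩ := hWpos j i
    linarith [hW1 j i hij]
  -- key estimate for k ≠ i
  have hkey : ∀ j k, i < j → k < j → β j * D j j / D j i * (p k / D k j)
      ≤ c / 3 * (p k / D k i) * (2 * W j i + W j k) := by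
    intro j k hij hkj
    have e1 := hD j i
    have e2 := hD k j
    have e3 := hD k i
    have e4 := hD j j
    have e5 := hb0 j
    have a1 := hWa j i hij
    have a2 := hWb j k hkj
    have a3 : D j j / D k j ≤ 1 := by
      have : D j j / D k j ≤ β j * D j j / D k j := by
        apply div_le_div_of_nonneg_right _ e2.le
        nlinarith [hβ j]
      linarith [hW2 j k hkj]
    have q0 : 0 ≤ p k / D k i := div_nonneg (hp0 k) e3.le
    have id1 : β j * D j j / D j i * (p k / D k j)
        = (p k / D k i) * (β j * D j j / (D j i * D k j) * D k i) := by field_simp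
    have h1 : β j * D j j / (D j i * D k j) * D k i ≤
        β j * D j j / (D j i * D k j) * (c / 3 * (D k j + D j j + D j i)) :=
      mul_le_mul_of_nonneg_left (htri k j i) (by positivity)
    have id2 : β j * D j j / (D j i * D k j) * (c / 3 * (D k j + D j j + D j i))
        = c / 3 * (β j * D j j / D j i + β j * D j j / D j i * (D j j / D k j)
          + β j * D j j / D k j) := by field_simp
    have h3 : β j * D j j / D j i * (D j j / D k j) ≤ β j * D j j / D j i :=
      mul_le_of_le_one_right (by positivity) a3
    have h4 : β j * D j j / (D j i * D k j) * D k i ≤ c / 3 * (2 * W j i + W j k) := by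
      rw [id2] at h1
      refine h1.trans (mul_le_mul_of_nonneg_left (by linarith) (by positivity))
    rw [id1]
    calc _ ≤ (p k / D k i) * (c / 3 * (2 * W j i + W j k)) := mul_le_mul_of_nonneg_left h4 q0
      _ = _ := by ring
  have hdiv : ∀ j, p j = 2 * (β j * D j j) * (N + ∑ k ∈ Finset.Iio j, p k / D k j) := by
    intro j
    rw [hp j, ← Finset.sum_mul]; ring
  set B := ∑ k ∈ Finset.Iio i, p k / D k i with hB
  set A := ∑ k ∈ Finset.Ioi i, p k / D k i with hA
  have hsplit : ∑ k ∈ Finset.univ.erase i, p k / D k i = B + A := by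
    rw [hA, hB, ← Finset.sum_union]
    · congr 1
      ext x
      simp only [Finset.mem_erase, Finset.mem_univ, and_true, Finset.mem_union, Finset.mem_Iio,
        Finset.mem_Ioi, ne_iff_lt_or_gt]
    · rw [Finset.disjoint_left]
      intro x hx hx'
      exact absurd (Finset.mem_Iio.1 hx) (not_lt.2 (Finset.mem_Ioi.1 hx').le)
  have hB0 : 0 ≤ B := Finset.sum_nonneg fun k _ => div_nonneg (hp0 k) (hD k i).le
  have hA0 : 0 ≤ A := Finset.sum_nonneg fun k _ => div_nonneg (hp0 k) (hD k i).le
  have hG0 : ∀ j k, 0 ≤ c / 3 * (p k / D k i) * (2 * W j i + W j k) := by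
    intro j k
    have := div_nonneg (hp0 k) (hD k i).le
    have := hW0 j i
    have := hW0 j k
    positivity
  have hterm : ∀ j, i < j → p j / D j i ≤ (2 * N + 4 * (N + B)) * W j i
      + ∑ k ∈ Finset.univ.erase i, 2 * (c / 3 * (p k / D k i) * (2 * W j i + W j k)) := by
    intro j hij
    have e0 := hD j i
    have id1 : p j / D j i = 2 * N * (β j * D j j / D j i)
        + 2 * (β j * D j j / D j i * (p i / D i j))
        + ∑ k ∈ (Finset.Iio j).erase i, 2 * (β j * D j j / D j i * (p k / D k j)) := by
      rw [hdiv j, ← Finset.add_sum_erase _ _ (Finset.mem_Iio.2 hij), ← Finset.mul_sum,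
        ← Finset.mul_sum]
      ring
    have id2 : β j * D j j / D j i * (p i / D i j)
        = 2 * (N + B) * (β j * β i * (D j j * D i i) / (D j i * D i j)) := by
      rw [hdiv i, ← hB]
      have := hD i j
      field_simp
    have b1 : ∑ k ∈ (Finset.Iio j).erase i, 2 * (β j * D j j / D j i * (p k / D k j))
        ≤ ∑ k ∈ Finset.univ.erase i, 2 * (c / 3 * (p k / D k i) * (2 * W j i + W j k)) := by
      refine (Finset.sum_le_sum (fun k hk => ?_)).trans
        (Finset.sum_le_sum_of_subset_of_nonneg
          (Finset.erase_subset_erase i (Finset.subset_univ _))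
          (fun k _ _ => mul_nonneg (by norm_num) (hG0 j k)))
      exact mul_le_mul_of_nonneg_left
        (hkey j k hij (Finset.mem_Iio.1 (Finset.mem_of_mem_erase hk))) (by norm_num)
    have b2 := mul_le_mul_of_nonneg_left (hWa j i hij) (by positivity : 0 ≤ 2 * N)
    have b3 := mul_le_mul_of_nonneg_left (hWc j i hij) (by positivity : 0 ≤ 2 * (N + B))
    rw [id1, id2]
    linarith
  have hmain : A ≤ (2 * N + 4 * (N + B)) * τ + 2 * c * τ * (B + A) := by
    calc A ≤ ∑ j ∈ Finset.Ioi i, ((2 * N + 4 * (N + B)) * W j i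
      + ∑ k ∈ Finset.univ.erase i, 2 * (c / 3 * (p k / D k i) * (2 * W j i + W j k))) :=
          Finset.sum_le_sum fun j hj => hterm j (Finset.mem_Ioi.1 hj)
      _ ≤ ∑ j, ((2 * N + 4 * (N + B)) * W j i
      + ∑ k ∈ Finset.univ.erase i, 2 * (c / 3 * (p k / D k i) * (2 * W j i + W j k))) := by
          refine Finset.sum_le_sum_of_subset_of_nonneg (Finset.subset_univ _) (fun j _ _ => ?_)
          exact add_nonneg (mul_nonneg (by positivity) (hW0 j i))
            (Finset.sum_nonneg fun k _ => mul_nonneg (by norm_num) (hG0 j k))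
      _ = (2 * N + 4 * (N + B)) * ∑ j, W j i
      + ∑ k ∈ Finset.univ.erase i, 2 * (c / 3 * (p k / D k i) *
          (2 * ∑ j, W j i + ∑ j, W j k)) := by
          rw [Finset.sum_add_distrib, ← Finset.mul_sum, Finset.sum_comm]
          congr 1
          refine Finset.sum_congr rfl fun k _ => ?_
          rw [← Finset.mul_sum, ← Finset.mul_sum, Finset.sum_add_distrib, ← Finset.mul_sum]
      _ ≤ (2 * N + 4 * (N + B)) * τ
      + ∑ k ∈ Finset.univ.erase i, 2 * c * τ * (p k / D k i) := by
          refine add_le_add (mul_le_mul_of_nonneg_left (hsel i) (by positivity))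
            (Finset.sum_le_sum fun k _ => ?_)
          have q0 := div_nonneg (hp0 k) (hD k i).le
          have h1 : c / 3 * (p k / D k i) * (2 * ∑ j, W j i + ∑ j, W j k)
              ≤ c / 3 * (p k / D k i) * (3 * τ) :=
            mul_le_mul_of_nonneg_left (by linarith [hsel i, hsel k]) (by positivity)
          linarith
      _ = _ := by rw [← Finset.mul_sum, hsplit]
  have hτ' : τ * (6 * c + 2) = 1 := by
    rw [hτ]; field_simp
  have hfin : A ≤ N + B := by
    by_contra hcon
    push Not at hcon
    have h1 : A * (τ * (6 * c + 2)) ≤ τ * (6 * N + 4 * B + 2 * c * (B + A)) := by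
      rw [hτ', mul_one]; linarith
    have h2 : A * (6 * c + 2) ≤ 6 * N + 4 * B + 2 * c * (B + A) := by
      by_contra h
      push Not at h
      nlinarith [mul_lt_mul_of_pos_left h hτ0]
    have h3 : (N + B) * (4 * c + 2) < A * (4 * c + 2) :=
      mul_lt_mul_of_pos_right hcon (by linarith)
    nlinarith [mul_nonneg hB0 (sub_nonneg.2 hc), mul_nonneg hN.le (sub_nonneg.2 hc)]
  rw [hsplit, le_div_iff₀ (by linarith)]
  have : p i / D i i = 2 * β i * (N + B) := by
    rw [hdiv i, ← hB]
    have := hD i i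
    field_simp
  rw [this]
  nlinarith [hb0 i]

/-- Feasibility of the power assignment computed by the unlimited-power algorithm
for capacity maximization with individual thresholds: if the links `ℓ_1, …, ℓ_n`
(ordered by nonincreasing sensitivity) all satisfy the greedy selection condition
`Σ_j w(ℓ_j, ℓ_i) ≤ τ` with `τ = 1/(6·3^α + 2)`, then the recursively defined powers
yield SINR at least `β i` for every link. -/
theorem capacity_unlimited_power_feasibility
    {X : Type*} [MetricSpace X] (α N : ℝ) (hα : 1 ≤ α) (hN : 0 < N)
    (n : ℕ) (s r : Fin n → X) (β : Fin n → ℝ)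
    (hβ : ∀ i, 1 ≤ β i)
    (hd : ∀ i, 0 < dist (s i) (r i))
    (hcross : ∀ i j, i ≠ j → 0 < dist (s i) (r j))
    (hord : ∀ i j : Fin n, i ≤ j →
      β j * dist (s j) (r j) ^ α ≤ β i * dist (s i) (r i) ^ α)
    (τ : ℝ) (hτ : τ = 1 / (6 * (3:ℝ) ^ α + 2))
    (hsel : ∀ i : Fin n, ∑ j, weight α s r β (fun t => (t : ℕ)) j i ≤ τ)
    (p : Fin n → ℝ)
    (hp : ∀ i : Fin n, p i = 2 * β i * N * dist (s i) (r i) ^ α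
      + 2 * β i * ∑ j ∈ Finset.Iio i, p j / dist (s j) (r i) ^ α * dist (s i) (r i) ^ α) :
    ∀ i : Fin n, β i ≤ sinr α N s r p Finset.univ i := by
  intro i
  have hdp : ∀ i j, 0 < dist (s i) (r j) := by
    intro i j
    by_cases h : i = j
    · subst h; exact hd i
    · exact hcross i j h
  refine aux_abstract n N ((3:ℝ) ^ α) τ hN (Real.one_le_rpow (by norm_num) (by linarith)) hτ
    (fun i j => dist (s i) (r j) ^ α) (fun i j => Real.rpow_pos_of_pos (hdp i j) α) β hβ ?_
    (fun j i => weight α s r β (fun t => (t : ℕ)) j i) ?_ ?_ hsel p hp i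
  · intro k j i
    refine aux_rpow_three α _ _ _ _ hα dist_nonneg dist_nonneg dist_nonneg dist_nonneg ?_
    have := dist_triangle4 (s k) (r j) (s j) (r i)
    rwa [dist_comm (r j) (s j)] at this
  · intro j i
    have hq : ∀ a b, 0 < dist (s a) (r b) ^ α := fun a b => Real.rpow_pos_of_pos (hdp a b) α
    have h1 := hq j j
    have h2 := hq i i
    have h3 := hq i j
    have h4 := hq j i
    have h5 : 0 < β j := lt_of_lt_of_le one_pos (hβ j)
    have h6 : 0 < β i := lt_of_lt_of_le one_pos (hβ i)
    simp only [weight]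
    split_ifs
    · positivity
    · exact le_refl _
  · intro j i hij
    have hij' : (i : ℕ) < (j : ℕ) := hij
    simp only [weight, if_pos hij']
end

section
/- Let ℓ_1=(s_1,r_1),…,ℓ_n=(s_n,r_n) be links indexed so that β_1·d(ℓ_1)^α ≥ … ≥ β_n·d(ℓ_n)^α, let τ = 1/(6·3^α + 2), suppose Σ_{j=1}^n w(ℓ_j, ℓ_i) ≤ τ for every i, and define powers p_i = 2·β_i·N·dist(s_i,r_i)^α + 2·Σ_{j<i} p_{i,j}, where p_{i,j} = β_i·p_j·dist(s_i,r_i)^α / dist(s_j,r_i)^α. Then for all i, k ∈ {1,…,n}: Σ_{j = max{i,k}+1}^{n} p_{j,k}/dist(s_j,r_i)^α ≤ 2·3^α·τ·p_k/dist(s_k,r_i)^α. -/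
open Finset

/-- The indirect effect of a link can be bounded by its direct effect: with links ordered
by nonincreasing sensitivity, `τ = 1/(6·3^α+2)`, the greedy condition `Σ_j w(ℓ_j,ℓ_i) ≤ τ`,
and powers `p_i = 2 β_i N d_i^α + 2 Σ_{j<i} p_{i,j}` where
`p_{i,j} = β_i p_j d(s_i,r_i)^α / d(s_j,r_i)^α`, we have for all `i, k`:
`Σ_{j > max{i,k}} p_{j,k}/d(s_j,r_i)^α ≤ 2·3^α·τ·p_k/d(s_k,r_i)^α`. -/
theorem indirect_effect_bound
    {X : Type*} [MetricSpace X] (α N : ℝ) (hα : 1 ≤ α) (hN : 0 < N)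
    (n : ℕ) (s r : Fin n → X) (β : Fin n → ℝ)
    (hβ : ∀ i, 1 ≤ β i)
    (hd : ∀ i, 0 < dist (s i) (r i))
    (hcross : ∀ i j, i ≠ j → 0 < dist (s i) (r j))
    (hord : ∀ i j : Fin n, i ≤ j →
      β j * dist (s j) (r j) ^ α ≤ β i * dist (s i) (r i) ^ α)
    (τ : ℝ) (hτ : τ = 1 / (6 * (3:ℝ) ^ α + 2))
    (hsel : ∀ i : Fin n, ∑ j, weight α s r β (fun t => (t : ℕ)) j i ≤ τ)
    (p : Fin n → ℝ) (pp : Fin n → Fin n → ℝ)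
    (hpp : ∀ i j : Fin n,
      pp i j = β i * p j * dist (s i) (r i) ^ α / dist (s j) (r i) ^ α)
    (hp : ∀ i : Fin n, p i = 2 * β i * N * dist (s i) (r i) ^ α
      + 2 * ∑ j ∈ Finset.Iio i, pp i j) :
    ∀ i k : Fin n,
      ∑ j ∈ Finset.Ioi (max i k), pp j k / dist (s j) (r i) ^ α
        ≤ 2 * (3:ℝ) ^ α * τ * (p k / dist (s k) (r i) ^ α) := by
  have hα0 : 0 ≤ α := by linarith
  have h3 : (0:ℝ) < 3 ^ α := by positivity
  have hτ1 : τ < 1 := by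
    rw [hτ, div_lt_one (by positivity)]; linarith
  have hA : ∀ i, 0 < β i * dist (s i) (r i) ^ α := fun i =>
    mul_pos (by linarith [hβ i]) (Real.rpow_pos_of_pos (hd i) _)
  have hD : ∀ i j, 0 < dist (s i) (r j) := by
    intro i j
    by_cases h : i = j
    · subst h; exact hd i
    · exact hcross i j h
  have hDα : ∀ i j, 0 < dist (s i) (r j) ^ α := fun i j => Real.rpow_pos_of_pos (hD i j) _
  have hβ0 : ∀ i, 0 < β i := fun i => by linarith [hβ i]
  have hp0 : ∀ m : ℕ, ∀ i : Fin n, (i : ℕ) = m → 0 ≤ p i := by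
    intro m
    induction m using Nat.strong_induction_on with
    | _ m ih =>
      intro i him
      rw [hp i]
      have h1 : 0 ≤ 2 * β i * N * dist (s i) (r i) ^ α := by
        have := hβ0 i
        positivity
      have h2 : 0 ≤ ∑ j ∈ Finset.Iio i, pp i j := by
        apply Finset.sum_nonneg
        intro j hj
        rw [Finset.mem_Iio] at hj
        have hpj : 0 ≤ p j := ih j (by rw [← him]; exact hj) j rfl
        rw [hpp]
        have := hβ0 i
        positivity
      linarith
  have hw0 : ∀ j i, 0 ≤ weight α s r β (fun t => (t : ℕ)) j i := by
    intro j i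
    unfold weight
    split_ifs
    · have := hβ0 i
      have := hβ0 j
      positivity
    · exact le_refl _
  have hwτ : ∀ j i, weight α s r β (fun t => (t : ℕ)) j i ≤ τ := fun j i =>
    (Finset.single_le_sum (f := fun j => weight α s r β (fun t => (t : ℕ)) j i)
      (fun j _ => hw0 j i) (Finset.mem_univ j)).trans (hsel i)
  have hw : ∀ j i : Fin n, i < j →
      β j * dist (s j) (r j) ^ α / dist (s j) (r i) ^ α ≤ weight α s r β (fun t => (t : ℕ)) j i ∧
      β j * dist (s j) (r j) ^ α / dist (s i) (r j) ^ α
        ≤ weight α s r β (fun t => (t : ℕ)) j i := by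
    intro j i hij
    have h1 := hwτ j i
    have hij' : (i : ℕ) < (j : ℕ) := hij
    have hbi := hβ0 i
    have hbj := hβ0 j
    have e1 : 0 ≤ β j * β i * (dist (s j) (r j) ^ α * dist (s i) (r i) ^ α) /
        (dist (s j) (r i) ^ α * dist (s i) (r j) ^ α) := by positivity
    have e2 : 0 ≤ β j * dist (s j) (r j) ^ α / dist (s j) (r i) ^ α := by positivity
    have e3 : 0 ≤ β j * dist (s j) (r j) ^ α / dist (s i) (r j) ^ α := by positivity
    unfold weight at h1 ⊢
    simp only [hij', if_true] at h1 ⊢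
    rcases min_le_iff.1 h1 with h | h
    · linarith
    · rw [min_eq_right (by linarith)]
      constructor <;> linarith
  intro i k
  have hpk := hp0 k k rfl
  have key : ∀ j ∈ Finset.Ioi (max i k), pp j k / dist (s j) (r i) ^ α ≤
      (p k / dist (s k) (r i) ^ α) * ((3:ℝ) ^ α * (weight α s r β (fun t => (t : ℕ)) j i
        + weight α s r β (fun t => (t : ℕ)) j k)) := by
    intro j hj
    rw [Finset.mem_Ioi, max_lt_iff] at hj
    obtain ⟨hi1, hi2⟩ := hw j i hj.1
    obtain ⟨hk1, hk2⟩ := hw j k hj.2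
    have hwi := hw0 j i
    have hwk := hw0 j k
    have a1 := hDα k i
    have a2 := hDα k j
    have a3 := hDα j i
    have aj := hA j
    have eq : pp j k / dist (s j) (r i) ^ α = (p k / dist (s k) (r i) ^ α) *
        (β j * dist (s j) (r j) ^ α * dist (s k) (r i) ^ α /
          (dist (s k) (r j) ^ α * dist (s j) (r i) ^ α)) := by
      rw [hpp]; field_simp
    rw [eq]
    apply mul_le_mul_of_nonneg_left _ (by positivity)
    have tri : dist (s k) (r i) ≤ dist (s k) (r j) + dist (s j) (r j) + dist (s j) (r i) := by
      have := dist_triangle4 (s k) (r j) (s j) (r i)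
      rwa [dist_comm (r j) (s j)] at this
    have hlt : dist (s j) (r j) < dist (s k) (r j) := by
      by_contra hcon
      push Not at hcon
      have h1 : dist (s k) (r j) ^ α ≤ dist (s j) (r j) ^ α :=
        Real.rpow_le_rpow dist_nonneg hcon hα0
      have h2 : dist (s j) (r j) ^ α ≤ β j * dist (s j) (r j) ^ α :=
        le_mul_of_one_le_left (hDα j j).le (hβ j)
      have h3 : 1 ≤ β j * dist (s j) (r j) ^ α / dist (s k) (r j) ^ α := by
        rw [one_le_div a2]; linarith
      linarith [hwτ j k]
    rcases le_total (dist (s j) (r i)) (dist (s k) (r j)) with h | h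
    · have h4 : dist (s k) (r i) ^ α ≤ 3 ^ α * dist (s k) (r j) ^ α := by
        rw [← Real.mul_rpow (by norm_num) dist_nonneg]
        exact Real.rpow_le_rpow dist_nonneg (by linarith) hα0
      calc _ ≤ β j * dist (s j) (r j) ^ α * (3 ^ α * dist (s k) (r j) ^ α) /
              (dist (s k) (r j) ^ α * dist (s j) (r i) ^ α) := by gcongr
        _ = 3 ^ α * (β j * dist (s j) (r j) ^ α / dist (s j) (r i) ^ α) := by field_simp
        _ ≤ _ := mul_le_mul_of_nonneg_left (by linarith) h3.le
    · have h4 : dist (s k) (r i) ^ α ≤ 3 ^ α * dist (s j) (r i) ^ α := by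
        rw [← Real.mul_rpow (by norm_num) dist_nonneg]
        exact Real.rpow_le_rpow dist_nonneg (by linarith) hα0
      calc _ ≤ β j * dist (s j) (r j) ^ α * (3 ^ α * dist (s j) (r i) ^ α) /
              (dist (s k) (r j) ^ α * dist (s j) (r i) ^ α) := by gcongr
        _ = 3 ^ α * (β j * dist (s j) (r j) ^ α / dist (s k) (r j) ^ α) := by field_simp
        _ ≤ _ := mul_le_mul_of_nonneg_left (by linarith) h3.le
  have hsum : ∀ i, ∑ j ∈ Finset.Ioi (max i k), weight α s r β (fun t => (t : ℕ)) j i ≤ τ ∧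
      ∑ j ∈ Finset.Ioi (max i k), weight α s r β (fun t => (t : ℕ)) j k ≤ τ := fun i =>
    ⟨(Finset.sum_le_sum_of_subset_of_nonneg (Finset.subset_univ _)
      (fun j _ _ => hw0 j i)).trans (hsel i),
     (Finset.sum_le_sum_of_subset_of_nonneg (Finset.subset_univ _)
      (fun j _ _ => hw0 j k)).trans (hsel k)⟩
  refine (Finset.sum_le_sum key).trans ?_
  rw [← Finset.mul_sum, ← Finset.mul_sum, Finset.sum_add_distrib, mul_comm]
  apply mul_le_mul_of_nonneg_right _ (div_nonneg hpk (hDα k i).le)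
  have := mul_le_mul_of_nonneg_left (add_le_add (hsum i).1 (hsum i).2) h3.le
  linarith
end

section
/- Let R be a finite set, let w : R × R → ℝ≥0, and let τ > 0 and c > 0 be real numbers. Let ALG ⊆ R and L' ⊆ R be subsets such that (i) Σ_{ℓ'∈L'} w(ℓ,ℓ') ≤ c for every ℓ ∈ R, and (ii) Σ_{ℓ∈ALG} w(ℓ,ℓ') > τ for every ℓ' ∈ L' \ ALG. Then |ALG| ≥ (τ/c)·|L' \ ALG|. (This is the double-counting core of the proof that the greedy capacity-maximization algorithm with individual thresholds is a constant-factor approximation.) -/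
open Finset

/-- Double-counting core of the constant-factor approximation proof for greedy
capacity maximization: if every element of `R` has outgoing weight at most `c`
into `L'`, and every rejected element of `L'` has incoming weight more than `τ`
from `ALG`, then `|ALG| ≥ (τ/c)·|L' \ ALG|`. -/
theorem greedy_double_counting {R : Type*} [Fintype R] [DecidableEq R]
    (w : R → R → ℝ) (hw : ∀ a b, 0 ≤ w a b)
    (τ c : ℝ) (hτ : 0 < τ) (hc : 0 < c)
    (ALG L' : Finset R)
    (hout : ∀ ℓ : R, ∑ ℓ' ∈ L', w ℓ ℓ' ≤ c)
    (hrej : ∀ ℓ' ∈ L' \ ALG, τ < ∑ ℓ ∈ ALG, w ℓ ℓ') :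
    (τ / c) * ((L' \ ALG).card : ℝ) ≤ (ALG.card : ℝ) := by
  have h1 : ((L' \ ALG).card : ℝ) * τ ≤ ∑ ℓ' ∈ L' \ ALG, ∑ ℓ ∈ ALG, w ℓ ℓ' := by
    rw [← nsmul_eq_mul]
    exact Finset.card_nsmul_le_sum _ _ _ (fun x hx => (hrej x hx).le)
  have h2 : ∑ ℓ ∈ ALG, ∑ ℓ' ∈ L' \ ALG, w ℓ ℓ' ≤ (ALG.card : ℝ) * c := by
    rw [← nsmul_eq_mul]
    refine Finset.sum_le_card_nsmul _ _ _ (fun x _ => le_trans ?_ (hout x))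
    exact Finset.sum_le_sum_of_subset_of_nonneg Finset.sdiff_subset (fun y _ _ => hw x y)
  rw [Finset.sum_comm] at h1
  rw [div_mul_eq_mul_div, div_le_iff₀ hc]
  linarith
end

section
/- Let L be a finite set of links that is admissible with respect to the thresholds β(ℓ). Then for every real c ≥ 1 there is a partition of L into at most ⌈2c⌉² sets, each of which is admissible with respect to the scaled thresholds β'(ℓ) = c·β(ℓ). (Signal strengthening: in particular, for integer c the number of parts is at most 4c².) -/
open Finset

/-- A set `L` of links is admissible if some nonnegative power assignment gives
every link of `L` an SINR at least its threshold `β`. -/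
def Admissible {X : Type*} {ι : Type*} [MetricSpace X] [DecidableEq ι]
    (α N : ℝ) (s r : ι → X) (β : ι → ℝ) (L : Finset ι) : Prop :=
  ∃ p : ι → ℝ, (∀ i ∈ L, 0 ≤ p i) ∧ ∀ i ∈ L, β i ≤ sinr α N s r p L i


theorem first_fit_aux {ι : Type*} [DecidableEq ι] (e : ι → ℤ) (w : ι → ι → ℝ)
    (m : ℕ) (hm : 0 < m) (S : Finset ι) :
    ∃ g : ι → ℕ, (∀ i, g i < m) ∧ ∀ i ∈ S,
      (m : ℝ) * ∑ j ∈ S with (e j < e i ∧ g j = g i), w i j ≤ ∑ j ∈ S with e j < e i, w i j := by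
  induction S using Finset.induction_on_max_value e with
  | empty => exact ⟨fun _ => 0, fun _ => hm, by simp⟩
  | insert a S ha hmax ih =>
    obtain ⟨g, hg, h⟩ := ih
    obtain ⟨t, ht, htle⟩ : ∃ t ∈ range m,
        (m : ℝ) * ∑ j ∈ S with (e j < e a ∧ g j = t), w a j ≤ ∑ j ∈ S with e j < e a, w a j := by
      by_contra! hcon
      have h1 := Finset.sum_lt_sum_of_nonempty (Finset.nonempty_range_iff.2 hm.ne') hcon
      rw [← Finset.mul_sum] at h1
      have h2 := Finset.sum_fiberwise_of_maps_to (s := {j ∈ S | e j < e a}) (t := range m) (g := g)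
        (fun i _ => Finset.mem_range.2 (hg i)) (w a)
      simp only [Finset.filter_filter] at h2
      rw [h2] at h1
      simp at h1
    refine ⟨Function.update g a t, ?_, ?_⟩
    · intro i
      by_cases hi : i = a
      · subst hi; simpa using ht
      · simpa [hi] using hg i
    · intro i hi
      have key : ∀ u : ℕ, {j ∈ insert a S | e j < e i ∧ Function.update g a t j = u}
          = {j ∈ S | e j < e i ∧ g j = u} := by
        intro u
        ext j
        by_cases hj : j = a
        · subst hj
          have : e i ≤ e j := by
            rcases Finset.mem_insert.1 hi with rfl | hi
            · exact le_rfl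
            · exact hmax i hi
          simp [ha, this.not_gt]
        · simp [hj]
      have key2 : {j ∈ insert a S | e j < e i} = {j ∈ S | e j < e i} := by
        have : e i ≤ e a := by
          rcases Finset.mem_insert.1 hi with rfl | hi
          · exact le_rfl
          · exact hmax i hi
        rw [Finset.filter_insert, if_neg this.not_gt]
      rw [key, key2]
      by_cases hia : i = a
      · subst hia; simpa using htle
      · simp only [Function.update_of_ne hia]
        exact h i ((Finset.mem_insert.1 hi).resolve_left hia)

/-- Signal strengthening: an admissible set `L` can be partitioned into at most
`⌈2c⌉²` sets, each admissible with respect to the scaled thresholds `c·β`. -/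
theorem signal_strengthening_partition
    {X : Type*} {ι : Type*} [MetricSpace X] [Fintype ι] [DecidableEq ι]
    (α N : ℝ) (hα : 1 ≤ α) (hN : 0 < N)
    (s r : ι → X) (β : ι → ℝ)
    (hβ : ∀ i, 1 ≤ β i)
    (hd : ∀ i, 0 < dist (s i) (r i))
    (hcross : ∀ i j, i ≠ j → 0 < dist (s i) (r j))
    (L : Finset ι) (hL : Admissible α N s r β L)
    (c : ℝ) (hc : 1 ≤ c) :
    ∃ (k : ℕ) (f : ι → ℕ), k ≤ (Nat.ceil (2 * c)) ^ 2 ∧ (∀ i ∈ L, f i < k) ∧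
      ∀ t : ℕ, Admissible α N s r (fun i => c * β i)
        (L.filter (fun i => f i = t)) := by
  classical
  obtain ⟨p, hp, hs⟩ := hL
  set m := Nat.ceil (2 * c) with hmdef
  have hm2 : 2 * c ≤ (m : ℝ) := Nat.le_ceil _
  have hm : 0 < m := Nat.ceil_pos.2 (by linarith)
  let e : ι → ℤ := fun i => ((Fintype.equivFin ι i : ℕ) : ℤ)
  have he : ∀ i j, i ≠ j → e j < e i ∨ -e j < -e i := by
    intro i j hij
    have : e i ≠ e j := by
      intro h
      apply hij
      have h' : ((Fintype.equivFin ι i : ℕ)) = (Fintype.equivFin ι j : ℕ) := Int.ofNat.inj h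
      exact (Fintype.equivFin ι).injective (Fin.ext h')
    omega
  let w : ι → ι → ℝ := fun i j => p j / dist (s j) (r i) ^ α
  have hw : ∀ i, ∀ j ∈ L, 0 ≤ w i j := fun i j hj =>
    div_nonneg (hp j hj) (Real.rpow_nonneg dist_nonneg _)
  obtain ⟨g, hg, hg'⟩ := first_fit_aux e w m hm L
  obtain ⟨q, hq, hq'⟩ := first_fit_aux (fun i => - e i) w m hm L
  refine ⟨m ^ 2, fun i => g i + m * q i, le_rfl, ?_, ?_⟩
  · intro i _
    have h1 := hg i
    have h2 := hq i
    show g i + m * q i < m ^ 2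
    nlinarith
  intro t
  refine ⟨fun i => c * p i, ?_, ?_⟩
  · intro i hi
    exact mul_nonneg (by linarith) (hp i (Finset.mem_filter.1 hi).1)
  intro i hi
  obtain ⟨hiL, hit⟩ := Finset.mem_filter.1 hi
  have hsi := hs i hiL
  unfold sinr at hsi ⊢
  have hI0 : 0 ≤ ∑ j ∈ L.erase i, w i j :=
    Finset.sum_nonneg fun j hj => hw i j (Finset.mem_of_mem_erase hj)
  have hI : β i * ((∑ j ∈ L.erase i, w i j) + N) ≤ p i / dist (s i) (r i) ^ α :=
    (le_div_iff₀ (by linarith)).1 hsi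
  set C := (L.filter (fun i => g i + m * q i = t)).erase i with hC
  have hsum : ∑ j ∈ C, c * p j / dist (s j) (r i) ^ α = c * ∑ j ∈ C, w i j := by
    rw [Finset.mul_sum]
    exact Finset.sum_congr rfl fun j _ => by simp only [w]; ring
  have hC0 : 0 ≤ ∑ j ∈ C, w i j :=
    Finset.sum_nonneg fun j hj => hw i j (Finset.mem_filter.1 (Finset.mem_of_mem_erase hj)).1
  have hsub : C ⊆ {j ∈ L | e j < e i ∧ g j = g i} ∪ {j ∈ L | -e j < -e i ∧ q j = q i} := by
    intro j hj
    obtain ⟨hji, hj⟩ := Finset.mem_erase.1 hj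
    obtain ⟨hjL, hjt⟩ := Finset.mem_filter.1 hj
    have heq : g j + m * q j = g i + m * q i := by rw [hjt]; exact hit.symm
    have hgg : g j = g i := by
      have := congrArg (· % m) heq
      simpa [Nat.add_mul_mod_self_left, Nat.mod_eq_of_lt (hg _)] using this
    have hqq : q j = q i := by
      rw [hgg] at heq
      exact Nat.eq_of_mul_eq_mul_left hm (by omega)
    simp only [Finset.mem_union, Finset.mem_filter]
    rcases he i j (Ne.symm hji) with h | h
    · exact Or.inl ⟨hjL, h, hgg⟩
    · exact Or.inr ⟨hjL, h, hqq⟩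
  have hbound : ∑ j ∈ C, w i j ≤ ∑ j ∈ L with (e j < e i ∧ g j = g i), w i j
      + ∑ j ∈ L with (-e j < -e i ∧ q j = q i), w i j := by
    rw [← Finset.sum_union]
    · refine Finset.sum_le_sum_of_subset_of_nonneg hsub fun j hj _ => hw i j ?_
      rcases Finset.mem_union.1 hj with h | h <;> exact (Finset.mem_filter.1 h).1
    · rw [Finset.disjoint_left]
      intro j h1 h2
      have a1 := (Finset.mem_filter.1 h1).2.1
      have a2 := (Finset.mem_filter.1 h2).2.1
      omega
  have hle : ∀ e' : ι → ℤ, ∑ j ∈ L with e' j < e' i, w i j ≤ ∑ j ∈ L.erase i, w i j := by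
    intro e'
    refine Finset.sum_le_sum_of_subset_of_nonneg ?_
      fun j hj _ => hw i j (Finset.mem_of_mem_erase hj)
    intro j hj
    obtain ⟨h1, h2⟩ := Finset.mem_filter.1 hj
    refine Finset.mem_erase.2 ⟨?_, h1⟩
    rintro rfl
    exact lt_irrefl _ h2
  have b1 := (hg' i hiL).trans (hle e)
  have b2 := (hq' i hiL).trans (hle fun i => -e i)
  have hmC : (m : ℝ) * ∑ j ∈ C, w i j ≤ 2 * ∑ j ∈ L.erase i, w i j := by
    have := mul_le_mul_of_nonneg_left hbound (Nat.cast_nonneg (α := ℝ) m)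
    rw [mul_add] at this
    linarith
  have hcC : c * ∑ j ∈ C, w i j ≤ ∑ j ∈ L.erase i, w i j := by
    have := mul_le_mul_of_nonneg_right hm2 hC0
    linarith
  have hcC0 : 0 ≤ c * ∑ j ∈ C, w i j := mul_nonneg (by linarith) hC0
  rw [hsum, le_div_iff₀ (by linarith), mul_assoc, mul_div_assoc]
  refine mul_le_mul_of_nonneg_left (le_trans ?_ hI) (by linarith)
  exact mul_le_mul_of_nonneg_left (by linarith) (by linarith [hβ i])
end

section
/- Let L be a finite set of links that is admissible with respect to the thresholds β(ℓ). Then for every real c ≥ 1 there is a subset L' ⊆ L with |L'| ≥ |L| / ⌈2c⌉² such that L' is admissible with respect to the scaled thresholds β'(ℓ) = c·β(ℓ). -/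
open Finset

lemma exists_coloring {ι : Type*} [DecidableEq ι] (g : ι → ℤ) (w : ι → ι → ℝ) (k : ℕ) (hk : 0 < k)
    (L : Finset ι) : ∃ f : ι → Fin k, ∀ i ∈ L,
      (k : ℝ) * ∑ j ∈ L with (g j < g i ∧ f j = f i), w i j ≤ ∑ j ∈ L with g j < g i, w i j := by
  induction L using Finset.induction_on_max_value g with
  | empty => exact ⟨fun _ => ⟨0, hk⟩, by simp⟩
  | insert a s ha hmax ih =>
    obtain ⟨f, hf⟩ := ih
    have hne : (Finset.univ : Finset (Fin k)).Nonempty := ⟨⟨0, hk⟩, mem_univ _⟩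
    obtain ⟨c, -, hc⟩ : ∃ c ∈ (Finset.univ : Finset (Fin k)),
        (k : ℝ) * ∑ j ∈ s with (g j < g a ∧ f j = c), w a j ≤ ∑ j ∈ s with g j < g a, w a j := by
      apply Finset.exists_le_of_sum_le hne
      rw [← Finset.mul_sum]
      simp only [← Finset.filter_filter]
      rw [Finset.sum_fiberwise]
      simp
    refine ⟨Function.update f a c, ?_⟩
    intro i hi
    have hai : ¬ g a < g i := by
      rcases Finset.mem_insert.1 hi with rfl | h
      · exact lt_irrefl _
      · exact not_lt.2 (hmax i h)
    rw [Finset.filter_insert, Finset.filter_insert, if_neg (fun h => hai h.1), if_neg hai]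
    have key : ∀ d, Function.update f a c i = d →
        {j ∈ s | g j < g i ∧ Function.update f a c j = Function.update f a c i}
          = {j ∈ s | g j < g i ∧ f j = d} := by
      intro d hd
      apply Finset.filter_congr
      intro j hj
      have : j ≠ a := fun h => ha (h ▸ hj)
      rw [hd, Function.update_of_ne this]
    rcases Finset.mem_insert.1 hi with rfl | h
    · rw [key c (by simp)]
      exact hc
    · have : i ≠ a := fun h' => ha (h' ▸ h)
      rw [key (f i) (Function.update_of_ne this _ _)]
      exact hf i h

lemma one_pass {ι : Type*} [DecidableEq ι] (g : ι → ℤ) (w : ι → ι → ℝ) (k : ℕ) (hk : 0 < k)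
    (L : Finset ι) : ∃ L' ⊆ L, L.card ≤ k * L'.card ∧ ∀ i ∈ L',
      (k : ℝ) * ∑ j ∈ L' with g j < g i, w i j ≤ ∑ j ∈ L with g j < g i, w i j := by
  obtain ⟨f, hf⟩ := exists_coloring g w k hk L
  have hne : (Finset.univ : Finset (Fin k)).Nonempty := ⟨⟨0, hk⟩, mem_univ _⟩
  obtain ⟨c, -, hc⟩ : ∃ c ∈ (Finset.univ : Finset (Fin k)), L.card ≤ k * #{j ∈ L | f j = c} := by
    apply Finset.exists_le_of_sum_le hne
    rw [← Finset.mul_sum, ← Finset.card_eq_sum_card_fiberwise (fun _ _ => Finset.mem_coe.2 (mem_univ _))]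
    simp
  refine ⟨{j ∈ L | f j = c}, Finset.filter_subset _ _, hc, ?_⟩
  intro i hi
  obtain ⟨hiL, rfl⟩ := Finset.mem_filter.1 hi
  have := hf i hiL
  rw [Finset.filter_filter]
  simpa only [and_comm] using this

lemma two_pass {ι : Type*} [Fintype ι] [DecidableEq ι] (w : ι → ι → ℝ) (k : ℕ) (hk : 0 < k)
    (L : Finset ι) (hw : ∀ i ∈ L, ∀ j ∈ L, 0 ≤ w i j) :
    ∃ L' ⊆ L, L.card ≤ k ^ 2 * L'.card ∧ ∀ i ∈ L',
      (k : ℝ) * ∑ j ∈ L'.erase i, w i j ≤ 2 * ∑ j ∈ L.erase i, w i j := by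
  let e := Fintype.equivFin ι
  let g : ι → ℤ := fun i => ((e i : ℕ) : ℤ)
  have hg : ∀ i j, g i = g j → i = j := by
    intro i j h
    apply e.injective
    apply Fin.ext
    exact Int.ofNat_inj.1 h
  obtain ⟨A, hA, hAc, hAw⟩ := one_pass g w k hk L
  obtain ⟨B, hB, hBc, hBw⟩ := one_pass (fun i => - g i) w k hk A
  refine ⟨B, hB.trans hA, ?_, ?_⟩
  · calc L.card ≤ k * A.card := hAc
      _ ≤ k * (k * B.card) := Nat.mul_le_mul_left _ hBc
      _ = _ := by ring
  intro i hi
  have hiA := hB hi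
  have hiL := hA hiA
  have split : B.erase i = {j ∈ B | g j < g i} ∪ {j ∈ B | - g j < - g i} := by
    ext j
    simp only [mem_erase, mem_union, mem_filter]
    constructor
    · rintro ⟨h1, h2⟩
      rcases lt_trichotomy (g j) (g i) with h | h | h
      · exact Or.inl ⟨h2, h⟩
      · exact absurd (hg _ _ h) h1
      · exact Or.inr ⟨h2, by omega⟩
    · rintro (⟨h1, h2⟩ | ⟨h1, h2⟩)
      · exact ⟨by rintro rfl; omega, h1⟩
      · exact ⟨by rintro rfl; omega, h1⟩
  have hdisj : Disjoint {j ∈ B | g j < g i} {j ∈ B | - g j < - g i} := by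
    rw [Finset.disjoint_filter]
    intro j _ h
    omega
  rw [split, Finset.sum_union hdisj, mul_add]
  have h1 : (k : ℝ) * ∑ j ∈ B with g j < g i, w i j ≤ ∑ j ∈ L.erase i, w i j := by
    refine le_trans (mul_le_mul_of_nonneg_left (?_ : _ ≤ ∑ j ∈ A with g j < g i, w i j)
      (Nat.cast_nonneg k)) ((hAw i hiA).trans ?_)
    · apply Finset.sum_le_sum_of_subset_of_nonneg (Finset.filter_subset_filter _ hB)
      intro j hj _
      exact hw i hiL j (hA (Finset.mem_filter.1 hj).1)
    · apply Finset.sum_le_sum_of_subset_of_nonneg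
      · intro j hj
        obtain ⟨h, h'⟩ := Finset.mem_filter.1 hj
        exact Finset.mem_erase.2 ⟨by rintro rfl; omega, h⟩
      · intro j hj _
        exact hw i hiL j (Finset.mem_of_mem_erase hj)
  have h2 : (k : ℝ) * ∑ j ∈ B with - g j < - g i, w i j ≤ ∑ j ∈ L.erase i, w i j := by
    refine (hBw i hi).trans ?_
    apply Finset.sum_le_sum_of_subset_of_nonneg
    · intro j hj
      obtain ⟨h, h'⟩ := Finset.mem_filter.1 hj
      exact Finset.mem_erase.2 ⟨by rintro rfl; omega, hA h⟩
    · intro j hj _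
      exact hw i hiL j (Finset.mem_of_mem_erase hj)
  linarith

/-- Signal strengthening, subset version: an admissible set `L` has a subset of size
at least `|L| / ⌈2c⌉²` that is admissible with respect to the scaled thresholds `c·β`. -/
theorem signal_strengthening_subset
    {X : Type*} {ι : Type*} [MetricSpace X] [Fintype ι] [DecidableEq ι]
    (α N : ℝ) (hα : 1 ≤ α) (hN : 0 < N)
    (s r : ι → X) (β : ι → ℝ)
    (hβ : ∀ i, 1 ≤ β i)
    (hd : ∀ i, 0 < dist (s i) (r i))
    (hcross : ∀ i j, i ≠ j → 0 < dist (s i) (r j))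
    (L : Finset ι) (hL : Admissible α N s r β L)
    (c : ℝ) (hc : 1 ≤ c) :
    ∃ L' ⊆ L, (L.card : ℝ) / ((Nat.ceil (2 * c) : ℝ)) ^ 2 ≤ (L'.card : ℝ) ∧
      Admissible α N s r (fun i => c * β i) L' := by
  obtain ⟨p, hp0, hp⟩ := hL
  have hk : 0 < Nat.ceil (2 * c) := Nat.ceil_pos.2 (by linarith)
  have hkc : 2 * c ≤ (Nat.ceil (2 * c) : ℝ) := Nat.le_ceil _
  have hw : ∀ i ∈ L, ∀ j ∈ L, 0 ≤ p j / dist (s j) (r i) ^ α := fun i _ j hj =>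
    div_nonneg (hp0 j hj) (Real.rpow_nonneg dist_nonneg _)
  obtain ⟨L', hL', hcard, hsum⟩ :=
    two_pass (fun i j => p j / dist (s j) (r i) ^ α) _ hk L hw
  generalize Nat.ceil (2 * c) = k at *
  have hk' : (0 : ℝ) < k := by exact_mod_cast hk
  refine ⟨L', hL', ?_, fun i => c * p i, ?_, ?_⟩
  · rw [div_le_iff₀ (by positivity), mul_comm]
    exact_mod_cast hcard
  · intro i hi
    exact mul_nonneg (by linarith) (hp0 i (hL' hi))
  · intro i hi
    have h1 := hp i (hL' hi)
    have h2 := hsum i hi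
    have hβi := hβ i
    unfold sinr at h1 ⊢
    have e : ∑ j ∈ L'.erase i, c * p j / dist (s j) (r i) ^ α
        = c * ∑ j ∈ L'.erase i, p j / dist (s j) (r i) ^ α := by
      rw [Finset.mul_sum]
      exact Finset.sum_congr rfl (fun j _ => mul_div_assoc _ _ _)
    beta_reduce
    rw [e, mul_div_assoc c (p i)]
    have hS : 0 ≤ ∑ j ∈ L.erase i, p j / dist (s j) (r i) ^ α :=
      Finset.sum_nonneg fun j hj => hw i (hL' hi) j (Finset.mem_of_mem_erase hj)
    have hT : 0 ≤ ∑ j ∈ L'.erase i, p j / dist (s j) (r i) ^ α :=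
      Finset.sum_nonneg fun j hj => hw i (hL' hi) j (hL' (Finset.mem_of_mem_erase hj))
    generalize ∑ j ∈ L.erase i, p j / dist (s j) (r i) ^ α = S at *
    generalize ∑ j ∈ L'.erase i, p j / dist (s j) (r i) ^ α = T at *
    generalize p i / dist (s i) (r i) ^ α = P at *
    have hc0 : 0 < c := by linarith
    have hcT : 0 ≤ c * T := mul_nonneg hc0.le hT
    rw [le_div_iff₀ (by linarith)] at h1 ⊢
    have h3 : c * T ≤ S := by
      have := mul_le_mul_of_nonneg_right hkc hT
      linarith
    have h4 : β i * (c * T + N) ≤ P :=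
      (mul_le_mul_of_nonneg_left (by linarith) (by linarith)).trans h1
    rw [mul_assoc]
    exact mul_le_mul_of_nonneg_left h4 hc0.le
end

section
/- For every finite admissible set of links L there is a subset L' ⊆ L with |L'| ≥ |L|/72 such that the set of reversed links (L')* = {(r,s) : (s,r) ∈ L'} (with each reversed link keeping the threshold of its original link) is also admissible. -/
open Finset

theorem aux_nonneg {n : Type*} [Fintype n] [DecidableEq n] (B : Matrix n n ℝ)
    (hoff : ∀ i j, i ≠ j → B i j ≤ 0) (p : n → ℝ) (hp : ∀ i, 0 < p i)
    (hBp : ∀ i, 0 < ∑ j, B i j * p j) (x : n → ℝ) (hx : ∀ i, 0 ≤ ∑ j, B i j * x j) :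
    ∀ i, 0 ≤ x i := by
  intro i0
  obtain ⟨k, -, hk⟩ := Finset.exists_min_image Finset.univ (fun i => x i / p i) ⟨i0, Finset.mem_univ _⟩
  set t := x k / p k with ht
  have hxk : x k = t * p k := by rw [ht]; field_simp [(hp k).ne']
  have hge : ∀ j, t * p j ≤ x j := fun j => by
    have := hk j (Finset.mem_univ _)
    exact (le_div_iff₀ (hp j)).1 this
  have ht0 : 0 ≤ t := by
    by_contra hneg
    push Not at hneg
    have h1 : ∑ j, B k j * x j ≤ ∑ j, t * (B k j * p j) := by
      apply Finset.sum_le_sum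
      intro j _
      by_cases hkj : k = j
      · subst hkj; rw [hxk]; apply le_of_eq; ring
      · have := mul_le_mul_of_nonpos_left (hge j) (hoff k j hkj)
        linarith
    rw [← Finset.mul_sum] at h1
    have := mul_neg_of_neg_of_pos hneg (hBp k)
    linarith [hx k]
  exact le_trans (mul_nonneg ht0 (hp i0).le) (hge i0)

theorem aux_transpose {n : Type*} [Fintype n] [DecidableEq n] (B : Matrix n n ℝ)
    (hoff : ∀ i j, i ≠ j → B i j ≤ 0) (p : n → ℝ) (hp : ∀ i, 0 < p i)
    (hBp : ∀ i, 0 < ∑ j, B i j * p j) (N : ℝ) (hN : 0 ≤ N) :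
    ∃ q : n → ℝ, (∀ i, 0 ≤ q i) ∧ ∀ i, ∑ j, B j i * q j = N := by
  have key := aux_nonneg B hoff p hp hBp
  have hinj : Function.Injective B.mulVec := by
    intro x y hxy
    have h0 : ∀ i, ∑ j, B i j * (x j - y j) = 0 := by
      intro i
      have := congrFun hxy i
      simp only [Matrix.mulVec, dotProduct] at this
      simp only [mul_sub, Finset.sum_sub_distrib, this, sub_self]
    have h1 := key (fun j => x j - y j) (fun i => (h0 i).ge)
    have h2 := key (fun j => y j - x j) (fun i => by
      have e : ∑ j, B i j * (y j - x j) = -∑ j, B i j * (x j - y j) := by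
        rw [← Finset.sum_neg_distrib]; apply Finset.sum_congr rfl; intros; ring
      rw [e, h0 i, neg_zero])
    funext j
    have a := h1 j
    have b := h2 j
    linarith
  have hu : IsUnit B := Matrix.mulVec_injective_iff_isUnit.1 hinj
  have hdet : IsUnit B.det := (Matrix.isUnit_iff_isUnit_det B).1 hu
  have hinv : ∀ i j, 0 ≤ B⁻¹ i j := by
    intro i j
    refine key (fun k => B⁻¹ k j) (fun k => ?_) i
    have := congrFun (congrFun (Matrix.mul_nonsing_inv B hdet) k) j
    rw [Matrix.mul_apply] at this
    rw [this, Matrix.one_apply]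
    split_ifs <;> norm_num
  refine ⟨fun j => ∑ k, N * B⁻¹ k j, fun j => Finset.sum_nonneg fun k _ => mul_nonneg hN (hinv k j), ?_⟩
  intro i
  have e : ∀ k, ∑ j, B⁻¹ k j * B j i = (1 : Matrix n n ℝ) k i := by
    intro k
    rw [← Matrix.mul_apply, Matrix.nonsing_inv_mul B hdet]
  calc ∑ j, B j i * ∑ k, N * B⁻¹ k j = ∑ k, N * ∑ j, B⁻¹ k j * B j i := by
        simp only [Finset.mul_sum]
        rw [Finset.sum_comm]
        refine Finset.sum_congr rfl fun _ _ => Finset.sum_congr rfl fun _ _ => by ring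
    _ = N := by simp [e, Matrix.one_apply]

theorem aux_links {n : Type*} [Fintype n] [DecidableEq n] (L : Finset n) (A : n → n → ℝ)
    (c p : n → ℝ) (hA : ∀ i j, 0 ≤ A i j) (hc : ∀ i, 0 < c i) (hp : ∀ i ∈ L, 0 < p i)
    (h : ∀ i ∈ L, ∑ j ∈ L.erase i, A i j * p j < c i * p i) (N : ℝ) (hN : 0 ≤ N) :
    ∃ q : n → ℝ, (∀ i, 0 ≤ q i) ∧ ∀ i ∈ L, ∑ j ∈ L.erase i, A j i * q j + N = c i * q i := by
  have sumf : ∀ (A : n → n → ℝ) (x : n → ℝ) (i : n),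
      ∑ j, (if i = j then c i else if i ∈ L ∧ j ∈ L then - A i j else 0) * x j
        = c i * x i - if i ∈ L then ∑ j ∈ L.erase i, A i j * x j else 0 := by
    intro A x i
    rw [← Finset.add_sum_erase _ _ (Finset.mem_univ i), sub_eq_add_neg]
    congr 1
    · simp
    · split_ifs with hi
      · rw [← Finset.sum_neg_distrib]
        symm
        apply Finset.sum_subset_zero_on_sdiff (Finset.erase_subset_erase i (Finset.subset_univ L))
        · intro j hj
          simp only [Finset.mem_sdiff, Finset.mem_erase, Finset.mem_univ, and_true, not_and] at hj
          simp [Ne.symm hj.1, hj.2 hj.1]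
        · intro j hj
          simp only [Finset.mem_erase] at hj
          simp [Ne.symm hj.1, hj.2, hi]
      · rw [neg_zero]
        apply Finset.sum_eq_zero
        intro j hj
        simp only [Finset.mem_erase] at hj
        simp [Ne.symm hj.1, hi]
  have hp' : ∀ i, 0 < (fun i => if i ∈ L then p i else 1) i := by
    intro i
    by_cases hi : i ∈ L <;> simp [hi, hp]
  obtain ⟨q, hq, hqs⟩ := aux_transpose
    (fun i j => if i = j then c i else if i ∈ L ∧ j ∈ L then - A i j else 0)
    (by
      intro i j hij
      simp only [hij, if_false]
      split_ifs
      · linarith [hA i j]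
      · exact le_rfl)
    (fun i => if i ∈ L then p i else 1) hp'
    (by
      intro i
      rw [sumf]
      by_cases hi : i ∈ L
      · simp only [hi, if_true]
        have e : ∑ j ∈ L.erase i, A i j * (if j ∈ L then p j else 1)
            = ∑ j ∈ L.erase i, A i j * p j :=
          Finset.sum_congr rfl fun j hj => by rw [if_pos (Finset.mem_of_mem_erase hj)]
        rw [e]
        linarith [h i hi]
      · simp [hi, hc i])
    N hN
  refine ⟨q, hq, fun i hi => ?_⟩
  have h1 := hqs i
  have h2 := sumf (fun i j => A j i) q i
  have e : ∑ j, (if j = i then c j else if j ∈ L ∧ i ∈ L then - A j i else 0) * q j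
      = ∑ j, (if i = j then c i else if i ∈ L ∧ j ∈ L then - A j i else 0) * q j := by
    refine Finset.sum_congr rfl fun j _ => ?_
    by_cases hij : i = j
    · subst hij; rfl
    · simp only [hij, Ne.symm hij, if_false, and_comm]
  rw [e, h2, if_pos hi] at h1
  linarith

/-- Every admissible set `L` has a subset `L'` with `|L'| ≥ |L|/72` whose set of
reversed links (senders and receivers swapped, thresholds unchanged) is admissible. -/
theorem reversed_links_admissible
    {X : Type*} {ι : Type*} [MetricSpace X] [Fintype ι] [DecidableEq ι]
    (α N : ℝ) (hα : 1 ≤ α) (hN : 0 < N)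
    (s r : ι → X) (β : ι → ℝ)
    (hβ : ∀ i, 1 ≤ β i)
    (hd : ∀ i, 0 < dist (s i) (r i))
    (hcross : ∀ i j, i ≠ j → 0 < dist (s i) (r j))
    (L : Finset ι) (hL : Admissible α N s r β L) :
    ∃ L' ⊆ L, (L.card : ℝ) / 72 ≤ (L'.card : ℝ) ∧ Admissible α N r s β L' := by
  obtain ⟨p, hp0, hp⟩ := hL
  refine ⟨L, Finset.Subset.refl _, ?_, ?_⟩
  · have : (0 : ℝ) ≤ L.card := Nat.cast_nonneg _
    linarith
  have hda : ∀ i, 0 < dist (s i) (r i) ^ α := fun i => Real.rpow_pos_of_pos (hd i) _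
  have hb : ∀ i, 0 < β i := fun i => lt_of_lt_of_le one_pos (hβ i)
  have hA : ∀ i j, 0 ≤ (dist (s j) (r i) ^ α)⁻¹ := fun i j =>
    inv_nonneg.2 (Real.rpow_nonneg dist_nonneg _)
  have hS : ∀ i ∈ L, 0 ≤ ∑ j ∈ L.erase i, p j / dist (s j) (r i) ^ α := fun i _ =>
    Finset.sum_nonneg fun j hj => div_nonneg (hp0 j (Finset.mem_of_mem_erase hj))
      (Real.rpow_nonneg dist_nonneg _)
  have hmain : ∀ i ∈ L, ∑ j ∈ L.erase i, p j / dist (s j) (r i) ^ α + N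
      ≤ (β i * dist (s i) (r i) ^ α)⁻¹ * p i := by
    intro i hi
    have h1 := hp i hi
    unfold sinr at h1
    rw [le_div_iff₀ (by linarith [hS i hi]), le_div_iff₀ (hda i)] at h1
    rw [inv_mul_eq_div, le_div_iff₀ (mul_pos (hb i) (hda i))]
    linarith
  have hc : ∀ i, 0 < (β i * dist (s i) (r i) ^ α)⁻¹ := fun i =>
    inv_pos.2 (mul_pos (hb i) (hda i))
  obtain ⟨q, hq, hqe⟩ := aux_links L (fun i j => (dist (s j) (r i) ^ α)⁻¹)
    (fun i => (β i * dist (s i) (r i) ^ α)⁻¹) p hA hc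
    (fun i hi => by
      have := lt_of_lt_of_le (add_pos_of_nonneg_of_pos (hS i hi) hN) (hmain i hi)
      exact (pos_iff_pos_of_mul_pos this).1 (hc i))
    (fun i hi => by
      have e : ∑ j ∈ L.erase i, (dist (s j) (r i) ^ α)⁻¹ * p j
          = ∑ j ∈ L.erase i, p j / dist (s j) (r i) ^ α :=
        Finset.sum_congr rfl fun j _ => inv_mul_eq_div _ _
      simp only [e]
      linarith [hmain i hi])
    N hN.le
  refine ⟨q, fun i _ => hq i, fun i hi => ?_⟩
  have h1 := hqe i hi
  have e : ∑ j ∈ L.erase i, (dist (s i) (r j) ^ α)⁻¹ * q j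
      = ∑ j ∈ L.erase i, q j / dist (r j) (s i) ^ α :=
    Finset.sum_congr rfl fun j _ => by rw [inv_mul_eq_div, dist_comm]
  simp only [e] at h1
  have hS' : 0 ≤ ∑ j ∈ L.erase i, q j / dist (r j) (s i) ^ α :=
    Finset.sum_nonneg fun j _ => div_nonneg (hq j) (Real.rpow_nonneg dist_nonneg _)
  unfold sinr
  rw [le_div_iff₀ (by linarith), h1, dist_comm (r i) (s i)]
  have := (hb i).ne'
  have := (hda i).ne'
  apply le_of_eq
  field_simp
end

section
/- Let w be a weight function on ordered pairs of links with values in [0,1] and let c ≥ 1, C₀ ≥ 0 be constants such that: for any three links ℓ=(s,r), ℓ'=(s',r'), ℓ''=(s'',r'') with dist(s,r') ≤ 3·dist(s,r'') and π(ℓ') < π(ℓ''), one has w(ℓ,ℓ'') ≤ c·w(ℓ,ℓ'). Let L be a finite set of links such that L or its reversed set L* is admissible, and such that Σ_{ℓ'∈L} w(ℓ',ℓ) ≤ C₀ for every ℓ ∈ L. Then for every link ℓ ∈ R: Σ_{ℓ'∈L, π(ℓ') < π(ℓ)} w(ℓ',ℓ) ≤ (9^α + 1) + c·C₀. -/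
open Finset

lemma card_aux {ι : Type*} [DecidableEq ι] (B : Finset ι) (q : ι → ℝ) (M : ℝ) (hM : 0 ≤ M)
    (hq : ∀ k ∈ B, 0 < q k) (h : ∀ k ∈ B, ∑ j ∈ B.erase k, q j ≤ M * q k) :
    (B.card : ℝ) ≤ M + 1 := by
  rcases B.eq_empty_or_nonempty with rfl | hne
  · simp; linarith
  obtain ⟨k, hk, hmin⟩ := B.exists_min_image q hne
  have h1 : ((B.erase k).card : ℝ) * q k ≤ ∑ j ∈ B.erase k, q j := by
    rw [← nsmul_eq_mul]
    exact Finset.card_nsmul_le_sum _ _ _ (fun j hj => hmin j (Finset.mem_of_mem_erase hj))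
  have h2 : ((B.erase k).card : ℝ) ≤ M := le_of_mul_le_mul_right (h1.trans (h k hk)) (hq k hk)
  have h3 : (B.erase k).card + 1 = B.card := Finset.card_erase_add_one hk
  rw [← h3]; push_cast; linarith

lemma adm_aux {X : Type*} {ι : Type*} [MetricSpace X] [DecidableEq ι]
    (α N : ℝ) (hN : 0 < N) (s r : ι → X) (β : ι → ℝ) (hβ : ∀ i, 1 ≤ β i) (L : Finset ι)
    (h : Admissible α N s r β L) : ∃ p : ι → ℝ, (∀ i ∈ L, 0 ≤ p i) ∧ ∀ i ∈ L,
      0 < p i / dist (s i) (r i) ^ α ∧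
      ∑ j ∈ L.erase i, p j / dist (s j) (r i) ^ α ≤ p i / dist (s i) (r i) ^ α := by
  obtain ⟨p, hp, h⟩ := h
  refine ⟨p, hp, fun i hi => ?_⟩
  have h1 := (hβ i).trans (h i hi)
  unfold sinr at h1
  have hS : 0 ≤ ∑ j ∈ L.erase i, p j / dist (s j) (r i) ^ α :=
    Finset.sum_nonneg fun j hj => div_nonneg (hp j (Finset.mem_of_mem_erase hj))
      (Real.rpow_nonneg dist_nonneg _)
  rw [le_div_iff₀ (by linarith)] at h1
  constructor <;> linarith

/-- Geometry lemma (sender version): let `w` be a weight function with values in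
`[0,1]` such that `w(ℓ,ℓ'') ≤ c·w(ℓ,ℓ')` whenever `d(s,r') ≤ 3·d(s,r'')` and
`π(ℓ') < π(ℓ'')`. If `L` or its reversed set is admissible and the incoming
weight `Σ_{ℓ'∈L} w(ℓ',ℓ)` is at most `C₀` for every `ℓ ∈ L`, then for every
link `ℓ` of the ground set, `Σ_{ℓ'∈L, π(ℓ')<π(ℓ)} w(ℓ',ℓ) ≤ (9^α+1) + c·C₀`. -/
theorem geometry_lemma_senders
    {X : Type*} {ι : Type*} [MetricSpace X] [Fintype ι] [DecidableEq ι]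
    (α N : ℝ) (hα : 1 ≤ α) (hN : 0 < N)
    (s r : ι → X) (β : ι → ℝ) (π : ι → ℕ)
    (hβ : ∀ i, 1 ≤ β i)
    (hd : ∀ i, 0 < dist (s i) (r i))
    (hcross : ∀ i j, i ≠ j → 0 < dist (s i) (r j))
    (hπinj : Function.Injective π)
    (hπ : ∀ i j, π i < π j →
      β j * dist (s j) (r j) ^ α ≤ β i * dist (s i) (r i) ^ α)
    (w : ι → ι → ℝ) (hw0 : ∀ i j, 0 ≤ w i j) (hw1 : ∀ i j, w i j ≤ 1)
    (c C₀ : ℝ) (hc : 1 ≤ c) (hC₀ : 0 ≤ C₀)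
    (hcond : ∀ i i' i'' : ι, dist (s i) (r i') ≤ 3 * dist (s i) (r i'') →
      π i' < π i'' → w i i'' ≤ c * w i i')
    (L : Finset ι)
    (hadm : Admissible α N s r β L ∨ Admissible α N r s β L)
    (hin : ∀ i ∈ L, ∑ j ∈ L, w j i ≤ C₀) :
    ∀ i : ι, ∑ j ∈ L.filter (fun j => π j < π i), w j i
      ≤ ((9:ℝ) ^ α + 1) + c * C₀ := by
  intro i
  have h39 : (3:ℝ) ^ α ≤ 9 ^ α := Real.rpow_le_rpow (by norm_num) (by norm_num) (by linarith)
  have h3 : (0:ℝ) < 3 ^ α := Real.rpow_pos_of_pos (by norm_num) _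
  have hcC : 0 ≤ c * C₀ := mul_nonneg (by linarith) hC₀
  set L' := L.filter (fun j => π j < π i) with hL'
  rcases L'.eq_empty_or_nonempty with he | hne
  · rw [he]; simp; linarith
  obtain ⟨m, hm, hmin⟩ := L'.exists_min_image (fun j => dist (r j) (r i)) hne
  have hm' := Finset.mem_filter.1 hm
  set B := L'.filter (fun j => ¬ dist (s j) (r m) ≤ 3 * dist (s j) (r i)) with hB
  have hBL : ∀ j ∈ B, j ∈ L := fun j hj =>
    (Finset.mem_filter.1 (Finset.mem_filter.1 hj).1).1
  have hBs : B ⊆ L := hBL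
  -- geometry of the bad links
  have hbad : ∀ j ∈ B, 2 * dist (s j) (r i) < dist (r m) (r i) ∧
      dist (r m) (r i) < 2 * dist (s j) (r j) := by
    intro j hj
    obtain ⟨hj1, hj2⟩ := Finset.mem_filter.1 hj
    have a1 := dist_triangle_right (s j) (r m) (r i)
    have a2 := hmin j hj1
    have a3 := dist_triangle_left (r j) (r i) (s j)
    push Not at hj2
    constructor <;> linarith
  have hss : ∀ j ∈ B, ∀ k ∈ B, dist (s j) (s k) < dist (r m) (r i) := by
    intro j hj k hk
    have := dist_triangle_right (s j) (s k) (r i)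
    linarith [(hbad j hj).1, (hbad k hk).1]
  have hcard : (B.card : ℝ) ≤ 3 ^ α + 1 := by
    rcases hadm with h | h
    · obtain ⟨p, hp0, hp⟩ := adm_aux α N hN s r β hβ L h
      have hdpos : ∀ k, 0 < dist (s k) (r k) ^ α := fun k => Real.rpow_pos_of_pos (hd k) _
      refine card_aux B p _ h3.le (fun k hk => ?_) (fun k hk => ?_)
      · have := (hp k (hBL k hk)).1
        rwa [div_pos_iff_of_pos_right (hdpos k)] at this
      · have h1 : ∑ j ∈ B.erase k, p j / (3 ^ α * dist (s k) (r k) ^ α) ≤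
            p k / dist (s k) (r k) ^ α := by
          refine le_trans ?_ (hp k (hBL k hk)).2
          refine le_trans (Finset.sum_le_sum fun j hj => ?_)
            (Finset.sum_le_sum_of_subset_of_nonneg (Finset.erase_subset_erase k hBs)
              fun j hj _ => div_nonneg (hp0 j (Finset.mem_of_mem_erase hj))
                (Real.rpow_nonneg dist_nonneg _))
          obtain ⟨hjk, hjB⟩ := Finset.mem_erase.1 hj
          have hpos := hcross j k hjk
          refine div_le_div_of_nonneg_left (hp0 j (hBL j hjB)) (Real.rpow_pos_of_pos hpos _) ?_
          rw [← Real.mul_rpow (by norm_num) dist_nonneg]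
          refine Real.rpow_le_rpow dist_nonneg ?_ (by linarith)
          linarith [dist_triangle (s j) (s k) (r k), hss j hjB k hk, (hbad k hk).2]
        rw [← Finset.sum_div, div_le_div_iff₀ (mul_pos h3 (hdpos k)) (hdpos k)] at h1
        refine le_of_mul_le_mul_right ?_ (hdpos k)
        linarith
    · obtain ⟨p, hp0, hp⟩ := adm_aux α N hN r s β hβ L h
      refine card_aux B (fun k => p k / dist (r k) (s k) ^ α) _ h3.le
        (fun k hk => (hp k (hBL k hk)).1) (fun k hk => ?_)
      have h1 : ∑ j ∈ B.erase k, (p j / dist (r j) (s j) ^ α) / 3 ^ α ≤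
          p k / dist (r k) (s k) ^ α := by
        refine le_trans ?_ (hp k (hBL k hk)).2
        refine le_trans (Finset.sum_le_sum fun j hj => ?_)
          (Finset.sum_le_sum_of_subset_of_nonneg (Finset.erase_subset_erase k hBs)
            fun j hj _ => div_nonneg (hp0 j (Finset.mem_of_mem_erase hj))
              (Real.rpow_nonneg dist_nonneg _))
        obtain ⟨hjk, hjB⟩ := Finset.mem_erase.1 hj
        have hpos := hcross k j (Ne.symm hjk)
        rw [dist_comm] at hpos
        rw [div_div]
        refine div_le_div_of_nonneg_left (hp0 j (hBL j hjB)) (Real.rpow_pos_of_pos hpos _) ?_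
        rw [← Real.mul_rpow dist_nonneg (by norm_num)]
        refine Real.rpow_le_rpow dist_nonneg ?_ (by linarith)
        have := (hbad j hjB).2
        rw [dist_comm] at this
        linarith [dist_triangle (r j) (s j) (s k), hss j hjB k hk, dist_comm (r j) (s j),
          (hbad j hjB).2]
      rw [← Finset.sum_div, div_le_iff₀ h3] at h1
      linarith
  rw [← Finset.sum_filter_add_sum_filter_not L' (fun j => dist (s j) (r m) ≤ 3 * dist (s j) (r i))]
  have hA : ∑ j ∈ L'.filter (fun j => dist (s j) (r m) ≤ 3 * dist (s j) (r i)), w j i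
      ≤ c * C₀ := by
    calc _ ≤ ∑ j ∈ L'.filter (fun j => dist (s j) (r m) ≤ 3 * dist (s j) (r i)), c * w j m :=
          Finset.sum_le_sum fun j hj => hcond j m i (Finset.mem_filter.1 hj).2 hm'.2
      _ ≤ ∑ j ∈ L, c * w j m := Finset.sum_le_sum_of_subset_of_nonneg
          (fun j hj => (Finset.mem_filter.1 (Finset.mem_filter.1 hj).1).1)
          (fun j _ _ => mul_nonneg (by linarith) (hw0 j m))
      _ = c * ∑ j ∈ L, w j m := by rw [Finset.mul_sum]
      _ ≤ c * C₀ := mul_le_mul_of_nonneg_left (hin m hm'.1) (by linarith)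
  have hBw : ∑ j ∈ B, w j i ≤ B.card := by
    have := Finset.sum_le_card_nsmul B (fun j => w j i) 1 (fun j _ => hw1 j i)
    simpa using this
  linarith
end

section
/- Let p_max > 0 and let ℓ_1=(s_1,r_1),…,ℓ_n=(s_n,r_n) be links with thresholds β_i ≥ 1 such that for every i: (i) 4·β_i·N·dist(s_i,r_i)^α ≤ p_max, and (ii) β_i·Σ_{j<i} dist(s_i,r_i)^α / dist(s_j,r_i)^α ≤ 1/4. Define powers recursively by p_i = 2·β_i·N·dist(s_i,r_i)^α + 2·β_i·Σ_{j<i} (p_j/dist(s_j,r_i)^α)·dist(s_i,r_i)^α. Then p_i ≤ p_max for every i ∈ {1,…,n}. -/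
open Finset

/-- Power boundedness in the limited-power capacity-maximization algorithm: if every
selected link `ℓ_i` satisfies `4·β_i·N·d(s_i,r_i)^α ≤ p_max` and
`β_i·Σ_{j<i} d(s_i,r_i)^α/d(s_j,r_i)^α ≤ 1/4`, then the recursively assigned powers
never exceed `p_max`. -/
theorem limited_power_bound
    {X : Type*} [MetricSpace X] (α N : ℝ) (hα : 1 ≤ α) (hN : 0 < N)
    (n : ℕ) (s r : Fin n → X) (β : Fin n → ℝ)
    (hβ : ∀ i, 1 ≤ β i)
    (hd : ∀ i, 0 < dist (s i) (r i))
    (hcross : ∀ i j, i ≠ j → 0 < dist (s i) (r j))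
    (pmax : ℝ) (hpmax : 0 < pmax)
    (h1 : ∀ i, 4 * β i * N * dist (s i) (r i) ^ α ≤ pmax)
    (h2 : ∀ i : Fin n,
      β i * ∑ j ∈ Finset.Iio i, dist (s i) (r i) ^ α / dist (s j) (r i) ^ α ≤ 1 / 4)
    (p : Fin n → ℝ)
    (hp : ∀ i : Fin n, p i = 2 * β i * N * dist (s i) (r i) ^ α
      + 2 * β i * ∑ j ∈ Finset.Iio i, p j / dist (s j) (r i) ^ α * dist (s i) (r i) ^ α) :
    ∀ i, p i ≤ pmax := by
  intro i
  induction i using WellFoundedLT.induction with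
  | ind i ih =>
    have hb : 0 ≤ β i := le_trans zero_le_one (hβ i)
    have hS : ∑ j ∈ Finset.Iio i, p j / dist (s j) (r i) ^ α * dist (s i) (r i) ^ α
        ≤ pmax * ∑ j ∈ Finset.Iio i, dist (s i) (r i) ^ α / dist (s j) (r i) ^ α := by
      rw [Finset.mul_sum]
      apply Finset.sum_le_sum
      intro j hj
      have hpj := ih j (Finset.mem_Iio.mp hj)
      have hq : 0 ≤ dist (s i) (r i) ^ α / dist (s j) (r i) ^ α := by positivity
      calc p j / dist (s j) (r i) ^ α * dist (s i) (r i) ^ α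
          = p j * (dist (s i) (r i) ^ α / dist (s j) (r i) ^ α) := by ring
        _ ≤ _ := mul_le_mul_of_nonneg_right hpj hq
    have h3 := mul_le_mul_of_nonneg_left hS hb
    have h4 := mul_le_mul_of_nonneg_left (h2 i) hpmax.le
    have h5 := h1 i
    rw [hp i]
    linarith
end

section
/- Let S be a finite nonempty set with |S| = n, let u : S → ℝ≥0, and let B = max_{ℓ∈S} u(ℓ) with B > 0. Then Σ_{i=0}^{⌈log₂ n⌉ + 1} 2^{-i}·B·|{ℓ ∈ S : u(ℓ) ≥ 2^{-i}·B}| ≥ (1/4)·Σ_{ℓ∈S} u(ℓ). (This is the dyadic-level counting step in the proof that the flexible-rate capacity-maximization algorithm is an O(log n)-approximation.) -/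
open Finset

/-- Dyadic-level counting step of the `O(log n)`-approximation for flexible-rate
capacity maximization: with `B` the maximum utility and levels
`L_i = {ℓ : u ℓ ≥ 2^{-i}·B}`, we have
`Σ_{i=0}^{⌈log₂ n⌉+1} 2^{-i}·B·|L_i| ≥ (1/4)·Σ_ℓ u ℓ`. -/
theorem dyadic_level_counting {S : Type*} [Fintype S] [Nonempty S]
    (n : ℕ) (hn : n = Fintype.card S)
    (u : S → ℝ) (hu : ∀ x, 0 ≤ u x)
    (B : ℝ) (hB : IsGreatest (Set.range u) B) (hBpos : 0 < B) :
    (1 / 4) * ∑ x, u x ≤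
      ∑ i ∈ Finset.range (Nat.clog 2 n + 2),
        B / 2 ^ i * ((Finset.univ.filter (fun x => B / 2 ^ i ≤ u x)).card : ℝ) := by
  obtain ⟨⟨x0, hx0⟩, hmax⟩ := hB
  have hle : ∀ x, u x ≤ B := fun x => hmax ⟨x, rfl⟩
  have hsumB : B ≤ ∑ x, u x := by
    rw [← hx0]
    exact Finset.single_le_sum (f := u) (fun x _ => hu x) (Finset.mem_univ x0)
  have hswap : ∑ i ∈ Finset.range (Nat.clog 2 n + 2),
        B / 2 ^ i * ((Finset.univ.filter (fun x => B / 2 ^ i ≤ u x)).card : ℝ)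
      = ∑ x, ∑ i ∈ Finset.range (Nat.clog 2 n + 2),
          (if B / 2 ^ i ≤ u x then B / 2 ^ i else 0) := by
    rw [Finset.sum_comm]
    refine Finset.sum_congr rfl fun i _ => ?_
    rw [← Finset.sum_filter, Finset.sum_const, nsmul_eq_mul, mul_comm]
  rw [hswap]
  have hpt : ∀ x, u x ≤ 2 * (∑ i ∈ Finset.range (Nat.clog 2 n + 2),
          (if B / 2 ^ i ≤ u x then B / 2 ^ i else 0)) + B / 2 ^ (Nat.clog 2 n + 1) := by
    intro x
    have hnn : ∀ i ∈ Finset.range (Nat.clog 2 n + 2),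
        0 ≤ (if B / 2 ^ i ≤ u x then B / 2 ^ i else 0) := by
      intro i _
      split_ifs <;> positivity
    have hpos : 0 < B / 2 ^ (Nat.clog 2 n + 1) := by positivity
    by_cases h : B / 2 ^ (Nat.clog 2 n + 1) ≤ u x
    · classical
      have hex : ∃ i : ℕ, B / 2 ^ i ≤ u x := ⟨_, h⟩
      have h1 := Nat.find_spec hex
      have h2 : Nat.find hex ≤ Nat.clog 2 n + 1 := Nat.find_min' hex h
      have h3 : ∀ m < Nat.find hex, ¬ B / 2 ^ m ≤ u x := fun m hm => Nat.find_min hex hm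
      generalize Nat.find hex = j at h1 h2 h3
      have h4 := Finset.single_le_sum hnn (Finset.mem_range.2 (by omega : j < Nat.clog 2 n + 2))
      rw [if_pos h1] at h4
      have h5 : u x ≤ 2 * (B / 2 ^ j) := by
        rcases j with _ | m
        · have := hle x
          simp
          linarith
        · have := h3 m (Nat.lt_succ_self m)
          have e : 2 * (B / 2 ^ (m + 1)) = B / 2 ^ m := by
            rw [pow_succ]
            field_simp
          rw [e]
          linarith
      linarith
    · have := Finset.sum_nonneg hnn
      linarith
  have hsum := Finset.sum_le_sum (fun x (_ : x ∈ (Finset.univ : Finset S)) => hpt x)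
  rw [Finset.sum_add_distrib, ← Finset.mul_sum, Finset.sum_const, nsmul_eq_mul,
    Finset.card_univ, ← hn] at hsum
  have hn2 : (n : ℝ) ≤ 2 ^ (Nat.clog 2 n) := by
    exact_mod_cast Nat.le_pow_clog (by norm_num) n
  have hlast : (n : ℝ) * (B / 2 ^ (Nat.clog 2 n + 1)) ≤ B / 2 := by
    rw [pow_succ, ← mul_div_assoc, div_le_div_iff₀ (by positivity) (by norm_num)]
    nlinarith
  linarith
end
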